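/- Let λ > 0 and let Q_λ(y) = λ·sign(y+τ) be the dithered one-bit quantizer with dither τ uniformly distributed on [−λ,λ]^d. Then for any x ∈ ℝ^d and any y ∈ ℝ^d with ‖y‖_∞ ≤ λ, the expectation over τ satisfies E[⟨x, Q_λ(y)⟩²] = ⟨x,y⟩² + ‖x‖²·λ² − Σ_{i=1}^d x_i² y_i², where ‖·‖ is the Euclidean norm. -/

import Mathlib

open MeasureTheory
open scoped NNReal

/-- Sign convention: `sgn s = 1` if `s ≥ 0`, `sgn s = -1` if `s < 0`. -/
noncomputable def sgn (s : ℝ) : ℝ := if 0 ≤ s then 1 else -1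

/-- The uniform probability measure on the interval `[-lam, lam]`. -/
noncomputable def unifIcc (lam : ℝ) : Measure ℝ :=
  ((Real.toNNReal (2 * lam))⁻¹ : ℝ≥0) • volume.restrict (Set.Icc (-lam) lam)

instance (lam : ℝ) : IsFiniteMeasure (unifIcc lam) := by
  unfold unifIcc; infer_instance

open ProbabilityTheory

lemma sgn_measurable : Measurable sgn :=
  Measurable.ite measurableSet_Ici measurable_const measurable_const

lemma sgn_mul_self (s : ℝ) : sgn s * sgn s = 1 := by
  unfold sgn; split_ifs <;> norm_num

lemma sgn_norm (s : ℝ) : ‖sgn s‖ ≤ 1 := by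
  unfold sgn; split_ifs <;> simp

lemma unifIcc_prob {lam : ℝ} (h : 0 < lam) : IsProbabilityMeasure (unifIcc lam) := by
  constructor
  unfold unifIcc
  rw [Measure.smul_apply, ENNReal.smul_def, smul_eq_mul, Measure.restrict_apply_univ, Real.volume_Icc,
    show lam - -lam = 2 * lam by ring, ENNReal.ofReal, ← ENNReal.coe_mul, inv_mul_cancel₀]
  · rfl
  · simp [h]

lemma integral_sgn {lam : ℝ} (h : 0 < lam) (y : ℝ) (hy : |y| ≤ lam) :
    ∫ t, sgn (y + t) ∂(unifIcc lam) = y / lam := by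
  have hy' := abs_le.mp hy
  have e : ∀ t, sgn (y + t) = 2 * (Set.Ici (-y)).indicator (fun _ => (1:ℝ)) t - 1 := by
    intro t
    unfold sgn
    by_cases h0 : 0 ≤ y + t
    · rw [if_pos h0, Set.indicator_of_mem (by simp only [Set.mem_Ici]; linarith)]; norm_num
    · rw [if_neg h0, Set.indicator_of_notMem (by simp only [Set.mem_Ici]; linarith)]; norm_num
  have hs : Set.Ici (-y) ∩ Set.Icc (-lam) lam = Set.Icc (-y) lam := by
    ext t; simp only [Set.mem_inter_iff, Set.mem_Ici, Set.mem_Icc]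
    constructor
    · rintro ⟨a, b, c⟩; exact ⟨a, c⟩
    · rintro ⟨a, b⟩; exact ⟨a, by linarith, b⟩
  unfold unifIcc
  simp_rw [e]
  rw [integral_smul_nnreal_measure, integral_sub, integral_const_mul,
    integral_indicator_const _ measurableSet_Ici]
  · simp only [integral_const, Measure.real, Measure.restrict_apply measurableSet_Ici, hs,
      Measure.restrict_apply_univ, Real.volume_Icc]
    rw [ENNReal.toReal_ofReal (by linarith), ENNReal.toReal_ofReal (by linarith), NNReal.smul_def]
    simp only [NNReal.coe_inv, Real.coe_toNNReal _ (by linarith : 0 ≤ 2 * lam), smul_eq_mul]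
    field_simp
    ring
  · exact ((integrable_const (1:ℝ)).indicator measurableSet_Ici).const_mul 2
  · exact integrable_const _

/-- for the dithered one-bit quantizer `Q_λ(y) = λ·sign (y + τ)` with dither `τ`
uniformly distributed on `[−λ,λ]^d`, and for any `x ∈ ℝ^d` and `y ∈ ℝ^d` with `‖y‖_∞ ≤ λ`:
`E[⟨x, Q_λ(y)⟩²] = ⟨x,y⟩² + ‖x‖²·λ² − Σ_i x i² y i²` (Euclidean norm/inner product). -/
theorem expected_sq_inner_dithered_quantizer (d : ℕ)
    (lam : ℝ) (hlam : 0 < lam) (x y : Fin d → ℝ) (hy : ∀ i : Fin d, |y i| ≤ lam) :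
    (∫ τ : Fin d → ℝ,
        (∑ i : Fin d, x i * (lam * sgn (y i + τ i))) ^ 2
        ∂(Measure.pi fun _ : Fin d => unifIcc lam)) =
      (∑ i : Fin d, x i * y i) ^ 2 + (∑ i : Fin d, (x i) ^ 2) * lam ^ 2
        - ∑ i : Fin d, (x i) ^ 2 * (y i) ^ 2 := by
  have := unifIcc_prob hlam
  set P := Measure.pi fun _ : Fin d => unifIcc lam with hP
  have hm : ∀ i, Measurable fun t : ℝ => sgn (y i + t) := fun i =>
    sgn_measurable.comp (measurable_const.add measurable_id)
  have hmi : ∀ i, Measurable fun τ : Fin d → ℝ => sgn (y i + τ i) := fun i =>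
    (hm i).comp (measurable_pi_apply i)
  have hind : iIndepFun (fun (i : Fin d) (τ : Fin d → ℝ) => sgn (y i + τ i)) P :=
    iIndepFun_pi (X := fun i t => sgn (y i + t)) (fun i => (hm i).aemeasurable)
  have h1 : ∀ i, ∫ τ, sgn (y i + τ i) ∂P = y i / lam := by
    intro i
    rw [← integral_sgn hlam (y i) (hy i)]
    exact integral_comp_eval (μ := fun _ : Fin d => unifIcc lam) (i := i)
      (f := fun t => sgn (y i + t)) (hm i).aestronglyMeasurable
  have h2 : ∀ i j, ∫ τ, sgn (y i + τ i) * sgn (y j + τ j) ∂P =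
      y i * y j / lam ^ 2 + if i = j then 1 - y i * y j / lam ^ 2 else 0 := by
    intro i j
    by_cases hij : i = j
    · subst hij
      simp [sgn_mul_self]
    · rw [(hind.indepFun hij).integral_fun_mul_eq_mul_integral (hmi i).aestronglyMeasurable
        (hmi j).aestronglyMeasurable, h1, h1, if_neg hij]
      field_simp
      ring
  have hint : ∀ i j, Integrable (fun τ => sgn (y i + τ i) * sgn (y j + τ j)) P := by
    intro i j
    refine Integrable.of_bound ((hmi i).mul (hmi j)).aestronglyMeasurable 1 ?_
    refine Filter.Eventually.of_forall fun τ => ?_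
    rw [norm_mul]
    exact mul_le_one₀ (sgn_norm _) (norm_nonneg _) (sgn_norm _)
  have hexp : ∀ τ : Fin d → ℝ, (∑ i : Fin d, x i * (lam * sgn (y i + τ i))) ^ 2 =
      ∑ i, ∑ j, (x i * x j * lam ^ 2) * (sgn (y i + τ i) * sgn (y j + τ j)) := by
    intro τ
    rw [sq, Finset.sum_mul_sum]
    refine Finset.sum_congr rfl fun i _ => Finset.sum_congr rfl fun j _ => by ring
  simp_rw [hexp]
  rw [integral_finsetSum _ fun i _ => integrable_finsetSum _ fun j _ => (hint i j).const_mul _]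
  have h3 : ∀ i, ∫ τ, ∑ j, (x i * x j * lam ^ 2) * (sgn (y i + τ i) * sgn (y j + τ j)) ∂P =
      ∑ j, (x i * y i) * (x j * y j) + (x i ^ 2 * lam ^ 2 - x i ^ 2 * y i ^ 2) := by
    intro i
    rw [integral_finsetSum _ fun j _ => (hint i j).const_mul _]
    simp_rw [integral_const_mul, h2, mul_add, Finset.sum_add_distrib, mul_ite, mul_zero]
    rw [Finset.sum_ite_eq, if_pos (Finset.mem_univ _)]
    congr 1
    · refine Finset.sum_congr rfl fun j _ => by field_simp
    · field_simp
  simp_rw [h3]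
  rw [Finset.sum_add_distrib, Finset.sum_sub_distrib, ← Finset.sum_mul_sum, ← Finset.sum_mul]
  ring
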